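/- Fix n ≥ 4 and R > 0, index coordinates of ℝⁿ by ZMod n, and let V_i(x) := x_{i−1} (x_{i+1} e_i − x_i e_{i+1}) be the Lorenz splitting vector fields. Define the lifted vector fields Ṽ_i : ℝⁿ × ℝⁿ → ℝⁿ × ℝⁿ by Ṽ_i(x, η) := (V_i(x), (D V_i(x)) η), where D V_i(x) is the Fréchet derivative of V_i at x, and for smooth vector fields W₁, W₂ on ℝ²ⁿ define the Lie bracket [W₁, W₂](z) := (D W₂(z)) W₁(z) − (D W₁(z)) W₂(z). Set a := −R/√(4n−6), b := √2 R/√(2n−3), let x ∈ ℝⁿ be given by x₁ = x₂ = a and x_i = b for 3 ≤ i ≤ n, and let η ∈ ℝⁿ be given by η_i = (−1)^{i+1} for 1 ≤ i ≤ n when n is even, and by η_i = (−1)^{i+1} for 1 ≤ i ≤ n−1 with η_n = 0 when n is odd. Then the 2n − 2 vectors Ṽ_1(x, η), Ṽ_2(x, η), …, Ṽ_n(x, η), together with [Ṽ_i, Ṽ_{i+1}](x, η) for i = 1, …, n−2, are linearly independent in ℝ²ⁿ; equivalently, their span has dimension 2n − 2. -/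

import Mathlib

open Real

/-- The `j`-th Lorenz splitting vector field `V_j(x) = x_{j-1}(x_{j+1} e_j - x_j e_{j+1})`
on `ℝⁿ` with cyclic indices. -/
noncomputable def lorenzSplit (n : ℕ) [NeZero n] (j : ZMod n)
    (x : ZMod n → ℝ) : ZMod n → ℝ :=
  x (j - 1) •
    (x (j + 1) • (Pi.single j 1 : ZMod n → ℝ) - x j • (Pi.single (j + 1) 1 : ZMod n → ℝ))

/-- The lift `Ṽ(x, η) := (V(x), (DV(x)) η)` of a vector field `V` on `ℝⁿ` to the tangent
bundle `ℝⁿ × ℝⁿ`. -/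
noncomputable def liftField (n : ℕ) [NeZero n] (V : (ZMod n → ℝ) → (ZMod n → ℝ))
    (z : (ZMod n → ℝ) × (ZMod n → ℝ)) : (ZMod n → ℝ) × (ZMod n → ℝ) :=
  (V z.1, fderiv ℝ V z.1 z.2)

/-- The Lie bracket `[W₁, W₂](z) := (DW₂(z)) W₁(z) − (DW₁(z)) W₂(z)` of vector fields
on `ℝ²ⁿ`. -/
noncomputable def lieBracket (n : ℕ) [NeZero n]
    (W₁ W₂ : (ZMod n → ℝ) × (ZMod n → ℝ) → (ZMod n → ℝ) × (ZMod n → ℝ))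
    (z : (ZMod n → ℝ) × (ZMod n → ℝ)) : (ZMod n → ℝ) × (ZMod n → ℝ) :=
  fderiv ℝ W₂ z (W₁ z) - fderiv ℝ W₁ z (W₂ z)


/-- The polarised derivative of the splitting field. -/
noncomputable def lorT (n : ℕ) [NeZero n] (j : ZMod n) (x u : ZMod n → ℝ) : ZMod n → ℝ :=
  (u (j - 1) * x (j + 1) + x (j - 1) * u (j + 1)) • (Pi.single j 1 : ZMod n → ℝ)
    - (u (j - 1) * x j + x (j - 1) * u j) • (Pi.single (j + 1) 1 : ZMod n → ℝ)

theorem fderiv_of_poly {E F : Type*} [NormedAddCommGroup E] [NormedSpace ℝ E]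
    [NormedAddCommGroup F] [NormedSpace ℝ F] (f : E → F) (z v : E) (w u : F)
    (hf : DifferentiableAt ℝ f z) (h : ∀ t : ℝ, f (z + t • v) = f z + t • w + (t ^ 2) • u) :
    fderiv ℝ f z v = w := by
  rw [← hf.lineDeriv_eq_fderiv]
  have : HasLineDerivAt ℝ f w z v := by
    unfold HasLineDerivAt
    simp only [h]
    have h1 : HasDerivAt (fun t : ℝ => t • w) ((1 : ℝ) • w) 0 := (hasDerivAt_id (0 : ℝ)).smul_const w
    have h2 : HasDerivAt (fun t : ℝ => (t ^ 2) • u) ((2 * (0 : ℝ)) • u) 0 := by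
      have := (hasDerivAt_pow 2 (0 : ℝ)).smul_const u
      simpa using this
    have h3 := (h1.const_add (f z)).add h2
    simp only [one_smul, mul_zero, zero_smul, add_zero] at h3
    exact h3
  exact this.lineDeriv

theorem lorenz_diff (n : ℕ) [NeZero n] (j : ZMod n) : Differentiable ℝ (lorenzSplit n j) := by
  unfold lorenzSplit
  fun_prop

theorem lorenz_fderiv (n : ℕ) [NeZero n] (j : ZMod n) (x u : ZMod n → ℝ) :
    fderiv ℝ (lorenzSplit n j) x u = lorT n j x u := by
  apply fderiv_of_poly _ _ _ _ (lorenzSplit n j u) (lorenz_diff n j x)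
  intro t
  ext k
  simp only [lorenzSplit, lorT, Pi.add_apply, Pi.smul_apply, Pi.sub_apply, smul_eq_mul]
  ring

theorem lift_eq (n : ℕ) [NeZero n] (j : ZMod n) :
    liftField n (lorenzSplit n j) = fun z => (lorenzSplit n j z.1, lorT n j z.1 z.2) := by
  funext z
  simp only [liftField, lorenz_fderiv]

theorem lift_fderiv (n : ℕ) [NeZero n] (j : ZMod n) (x y u v : ZMod n → ℝ) :
    fderiv ℝ (liftField n (lorenzSplit n j)) (x, y) (u, v)
      = (lorT n j x u, lorT n j u y + lorT n j x v) := by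
  rw [lift_eq]
  apply fderiv_of_poly _ _ _ _ (lorenzSplit n j u, lorT n j u v)
  · unfold lorenzSplit lorT
    fun_prop
  · intro t
    ext k
    · simp only [lorenzSplit, lorT, Pi.add_apply, Pi.smul_apply, Pi.sub_apply, smul_eq_mul,
        Prod.smul_mk, Prod.mk_add_mk]
      ring
    · simp only [lorT, Pi.add_apply, Pi.smul_apply, Pi.sub_apply, smul_eq_mul,
        Prod.smul_mk, Prod.mk_add_mk]
      ring

theorem zmod_small (n : ℕ) (m : ℕ) (h0 : 0 < m) (h : m < n) : ((m : ℕ) : ZMod n) ≠ 0 := by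
  intro hh
  rw [ZMod.natCast_eq_zero_iff] at hh
  exact absurd (Nat.le_of_dvd h0 hh) (by omega)

/-- Explicit bracket, base part. -/
noncomputable def brA (n : ℕ) [NeZero n] (j : ZMod n) (x : ZMod n → ℝ) : ZMod n → ℝ :=
  (-(x (j - 1) * x j * x (j + 2))) • (Pi.single j 1 : ZMod n → ℝ)
  + (x (j - 1) * x (j + 1) * x (j + 2)) • (Pi.single (j + 1) 1 : ZMod n → ℝ)
  + (x (j - 1) * (x j ^ 2 - x (j + 1) ^ 2)) • (Pi.single (j + 2) 1 : ZMod n → ℝ)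

/-- Explicit bracket, fibre part. -/
noncomputable def brB (n : ℕ) [NeZero n] (j : ZMod n) (x y : ZMod n → ℝ) : ZMod n → ℝ :=
  (-(y (j - 1) * x j * x (j + 2) + x (j - 1) * y j * x (j + 2) + x (j - 1) * x j * y (j + 2)))
      • (Pi.single j 1 : ZMod n → ℝ)
  + (y (j - 1) * x (j + 1) * x (j + 2) + x (j - 1) * y (j + 1) * x (j + 2)
      + x (j - 1) * x (j + 1) * y (j + 2)) • (Pi.single (j + 1) 1 : ZMod n → ℝ)
  + (y (j - 1) * (x j ^ 2 - x (j + 1) ^ 2) + x (j - 1) * (2 * x j * y j - 2 * x (j + 1) * y (j + 1)))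
      • (Pi.single (j + 2) 1 : ZMod n → ℝ)

theorem bracket_eq (n : ℕ) [NeZero n] (hn : 4 ≤ n) (j : ZMod n) (x y : ZMod n → ℝ) :
    lieBracket n (liftField n (lorenzSplit n j)) (liftField n (lorenzSplit n (j + 1))) (x, y)
      = (brA n j x, brB n j x y) := by
  have h1 : (1 : ZMod n) ≠ 0 := by simpa using zmod_small n 1 (by omega) (by omega)
  have h2 : (2 : ZMod n) ≠ 0 := by simpa using zmod_small n 2 (by omega) (by omega)
  have h3 : (3 : ZMod n) ≠ 0 := by simpa using zmod_small n 3 (by omega) (by omega)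
  have e1 : j + 1 ≠ j := by intro h; apply h1; linear_combination h
  have e2 : j + 2 ≠ j := by intro h; apply h2; linear_combination h
  have e3 : j + 2 ≠ j + 1 := by intro h; apply h1; linear_combination h
  have e4 : j - 1 ≠ j := by intro h; apply h1; linear_combination -h
  have e5 : j - 1 ≠ j + 1 := by intro h; apply h2; linear_combination -h
  have e6 : j - 1 ≠ j + 2 := by intro h; apply h3; linear_combination -h
  have a1 : j + 1 - 1 = j := by ring
  have a2 : j + 1 + 1 = j + 2 := by ring
  unfold lieBracket
  have l1 : liftField n (lorenzSplit n j) (x, y) = (lorenzSplit n j x, lorT n j x y) := by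
    rw [lift_eq]
  have l2 : liftField n (lorenzSplit n (j + 1)) (x, y)
      = (lorenzSplit n (j + 1) x, lorT n (j + 1) x y) := by
    rw [lift_eq]
  rw [l1, l2, lift_fderiv, lift_fderiv]
  ext k
  · simp [lorenzSplit, lorT, brA, a1, a2, e1, e2, e3, e4, e5, e6, e1.symm, e2.symm, e3.symm]
    ring
  · simp [lorenzSplit, lorT, brB, a1, a2, e1, e2, e3, e4, e5, e6, e1.symm, e2.symm, e3.symm]
    ring

theorem sum_single (n : ℕ) [NeZero n] (f : ZMod n → ℝ) (r k : ZMod n) :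
    ∑ m, f m * (Pi.single (m + r) 1 : ZMod n → ℝ) k = f (k - r) := by
  rw [Finset.sum_eq_single (k - r)]
  · simp
  · intro m _ hm
    rw [Pi.single_eq_of_ne]
    · simp
    · intro h; apply hm; rw [h]; ring
  · simp

theorem sum_single0 (n : ℕ) [NeZero n] (f : ZMod n → ℝ) (k : ZMod n) :
    ∑ m, f m * (Pi.single m 1 : ZMod n → ℝ) k = f k := by
  simpa using sum_single n f 0 k

theorem eqE (n : ℕ) [NeZero n] (c d x : ZMod n → ℝ)
    (h : ∑ m, c m • lorenzSplit n m x + ∑ m, d m • brA n m x = 0) (k : ZMod n) :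
    c k * (x (k - 1) * x (k + 1)) - c (k - 1) * (x (k - 2) * x (k - 1))
      - d k * (x (k - 1) * x k * x (k + 2)) + d (k - 1) * (x (k - 2) * x k * x (k + 1))
      + d (k - 2) * (x (k - 3) * (x (k - 2) ^ 2 - x (k - 1) ^ 2)) = 0 := by
  have hk := congrFun h k
  have b1 : k - 1 - 1 = k - 2 := by ring
  have b2 : k - 1 + 2 = k + 1 := by ring
  have b3 : k - 2 - 1 = k - 3 := by ring
  have b4 : k - 2 + 1 = k - 1 := by ring
  simp only [lorenzSplit, brA, Pi.add_apply, Finset.sum_apply, Pi.smul_apply, Pi.sub_apply,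
    smul_eq_mul, Pi.zero_apply, mul_add, mul_sub, ← mul_assoc, Finset.sum_add_distrib,
    Finset.sum_sub_distrib, sum_single, sum_single0, b1, b2, b3, b4, sub_add_cancel] at hk
  linear_combination hk

theorem eqF (n : ℕ) [NeZero n] (c d x y : ZMod n → ℝ)
    (h : ∑ m, c m • lorT n m x y + ∑ m, d m • brB n m x y = 0) (k : ZMod n) :
    c k * (y (k - 1) * x (k + 1) + x (k - 1) * y (k + 1))
      - c (k - 1) * (y (k - 2) * x (k - 1) + x (k - 2) * y (k - 1))
      - d k * (y (k - 1) * x k * x (k + 2) + x (k - 1) * y k * x (k + 2)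
        + x (k - 1) * x k * y (k + 2))
      + d (k - 1) * (y (k - 2) * x k * x (k + 1) + x (k - 2) * y k * x (k + 1)
        + x (k - 2) * x k * y (k + 1))
      + d (k - 2) * (y (k - 3) * (x (k - 2) ^ 2 - x (k - 1) ^ 2)
        + x (k - 3) * (2 * x (k - 2) * y (k - 2) - 2 * x (k - 1) * y (k - 1))) = 0 := by
  have hk := congrFun h k
  have b1 : k - 1 - 1 = k - 2 := by ring
  have b2 : k - 1 + 2 = k + 1 := by ring
  have b3 : k - 2 - 1 = k - 3 := by ring
  have b4 : k - 2 + 1 = k - 1 := by ring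
  simp only [lorT, brB, Pi.add_apply, Finset.sum_apply, Pi.smul_apply, Pi.sub_apply,
    smul_eq_mul, Pi.zero_apply] at hk
  simp only [mul_add (c _), mul_add (d _), mul_sub (c _), ← mul_assoc (c _), ← mul_assoc (d _),
    Finset.sum_add_distrib,
    Finset.sum_sub_distrib, sum_single, sum_single0, b1, b2, b3, b4, sub_add_cancel] at hk
  linear_combination hk

/-- The algebraic core. -/
theorem core (n : ℕ) [NeZero n] (hn : 4 ≤ n) (s : ℝ) (hs : s ≠ 0) (c d x y : ZMod n → ℝ)
    (hx : ∀ m : ZMod n, x m = if m = 1 ∨ m = 2 then -s else 2 * s)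
    (hy : ∀ m : ZMod n, y m = if Even n then (-1 : ℝ) ^ (m.val + 1)
      else if m = 0 then 0 else (-1 : ℝ) ^ (m.val + 1))
    (d0 : d 0 = 0) (d1 : d (-1) = 0)
    (hE : ∑ m, c m • lorenzSplit n m x + ∑ m, d m • brA n m x = 0)
    (hF : ∑ m, c m • lorT n m x y + ∑ m, d m • brB n m x y = 0) :
    (∀ m, c m = 0) ∧ ∀ m, d m = 0 := by
  have E := eqE n c d x hE
  have F := eqF n c d x y hF
  have xb : ∀ m : ℕ, 3 ≤ m → m ≤ n → x (m : ZMod n) = 2 * s := by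
    intro m h3 hm
    rw [hx, if_neg]
    rintro (h | h)
    · apply zmod_small n (m - 1) (by omega) (by omega)
      rw [Nat.cast_sub (by omega), h]; simp
    · apply zmod_small n (m - 2) (by omega) (by omega)
      rw [Nat.cast_sub (by omega), h]; simp
  have ym : ∀ m : ℕ, 1 ≤ m → m < n → y (m : ZMod n) = (-1) ^ (m + 1) := by
    intro m h1 hm
    rw [hy, ZMod.val_natCast, Nat.mod_eq_of_lt hm]
    simp [zmod_small n m h1 hm]
  have x0 : x 0 = 2 * s := by simpa using xb n (by omega) le_rfl
  have x1 : x 1 = -s := by simp [hx]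
  have x2 : x 2 = -s := by simp [hx]
  have x3 : x 3 = 2 * s := by simpa using xb 3 (by omega) (by omega)
  have x4 : x 4 = 2 * s := by simpa using xb 4 (by omega) (by omega)
  have xm1 : x (-1) = 2 * s := by
    have := xb (n - 1) (by omega) (by omega)
    rw [Nat.cast_sub (by omega)] at this; simpa using this
  have y1 : y 1 = 1 := by have := ym 1 (by omega) (by omega); norm_num at this; exact this
  have y2 : y 2 = -1 := by have := ym 2 (by omega) (by omega); norm_num at this; exact this
  have y3 : y 3 = 1 := by have := ym 3 (by omega) (by omega); norm_num at this; exact this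
  have E1 := E 1
  have E2 := E 2
  have F1 := F 1
  have F2 := F 2
  have r1 : (1 : ZMod n) - 1 = 0 := by ring
  have r2 : (1 : ZMod n) + 1 = 2 := by ring
  have r3 : (1 : ZMod n) - 2 = -1 := by ring
  have r4 : (1 : ZMod n) + 2 = 3 := by ring
  have r5 : (2 : ZMod n) - 1 = 1 := by ring
  have r6 : (2 : ZMod n) + 1 = 3 := by ring
  have r7 : (2 : ZMod n) - 2 = 0 := by ring
  have r8 : (2 : ZMod n) + 2 = 4 := by ring
  simp only [r1, r2, r3, r4, r5, r6, r7, r8, d0, d1, x0, x1, x2, x3, x4, xm1, y1, y2, y3]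
    at E1 E2 F1 F2
  have y4 : 4 < n → y 4 = -1 := by
    intro h
    have := ym 4 (by omega) (by omega); norm_num at this; exact this
  have G1 : -2 * c 1 - 4 * c 0 + 4 * (s * d 1) = 0 := by
    have : s ^ 2 * (-2 * c 1 - 4 * c 0 + 4 * (s * d 1)) = 0 := by linear_combination E1
    simpa [hs] using this
  have G2 : -2 * c 2 + 2 * c 1 - 2 * (s * d 2) - 4 * (s * d 1) = 0 := by
    have : s ^ 2 * (-2 * c 2 + 2 * c 1 - 2 * (s * d 2) - 4 * (s * d 1)) = 0 := by
      linear_combination E2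
    simpa [hs] using this
  have key : c 0 = 0 ∧ s * d 1 = 0 := by
    by_cases ev : Even n
    · have y0 : y 0 = -1 := by simp [hy, ev]
      have ym1 : y (-1) = 1 := by
        have := ym (n - 1) (by omega) (by omega)
        rw [Nat.cast_sub (by omega), Nat.sub_add_cancel (by omega), ev.neg_one_pow] at this
        simpa using this
      have y4 : y 4 = -1 := by
        by_cases h : 4 < n
        · exact y4 h
        · have h4 : ((4 : ℕ) : ZMod n) = 0 := by
            have : n = 4 := by omega
            rw [← this]; simp
          have h4' : (4 : ZMod n) = 0 := by simpa using h4
          rw [h4', y0]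
      rw [y0, ym1] at F1
      rw [y0, y4] at F2
      have H1 : -c 1 - 4 * (s * d 1) = 0 := by
        have : s * (-c 1 - 4 * (s * d 1)) = 0 := by linear_combination F1
        simpa [hs] using this
      have H2 : c 2 - 3 * c 1 + s * d 2 - 4 * (s * d 1) = 0 := by
        have : s * (c 2 - 3 * c 1 + s * d 2 - 4 * (s * d 1)) = 0 := by linear_combination F2
        simpa [hs] using this
      constructor <;> linarith
    · have y0 : y 0 = 0 := by simp [hy, ev]
      have od : Odd n := Nat.not_even_iff_odd.mp ev
      have ym1 : y (-1) = -1 := by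
        have := ym (n - 1) (by omega) (by omega)
        rw [Nat.cast_sub (by omega), Nat.sub_add_cancel (by omega), od.neg_one_pow] at this
        simpa using this
      have y4 : y 4 = -1 := by
        apply y4
        rcases od with ⟨q, hq⟩
        omega
      rw [y0, ym1] at F1
      rw [y0, y4] at F2
      have H1 : -2 * c 1 + 2 * c 0 - 2 * (s * d 1) = 0 := by
        have : s * (-2 * c 1 + 2 * c 0 - 2 * (s * d 1)) = 0 := by linear_combination F1
        simpa [hs] using this
      have H2 : c 2 - 2 * c 1 + s * d 2 - 6 * (s * d 1) = 0 := by
        have : s * (c 2 - 2 * c 1 + s * d 2 - 6 * (s * d 1)) = 0 := by linear_combination F2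
        simpa [hs] using this
      constructor <;> linarith
  obtain ⟨c0, sd1⟩ := key
  have c1 : c 1 = 0 := by linarith
  have hd1 : d 1 = 0 := by simpa [hs] using sd1
  have c2 : c 2 = -(s * d 2) := by linarith
  -- downward induction
  have P : ∀ i : ℕ, i + 4 ≤ n → c ((n - i : ℕ) : ZMod n) = 0 ∧ d ((n - i : ℕ) : ZMod n) = 0 ∧
      d ((n - i - 1 : ℕ) : ZMod n) = 0 := by
    intro i
    induction i with
    | zero =>
      intro _
      refine ⟨by simpa using c0, by simpa using d0, ?_⟩
      rw [Nat.sub_zero, Nat.cast_sub (by omega)]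
      simpa using d1
    | succ i ih =>
      intro hi
      obtain ⟨p1, p2, p3⟩ := ih (by omega)
      obtain ⟨k, hk⟩ : ∃ k, n - i = k + 5 := ⟨n - i - 5, by omega⟩
      have hk1 : n - i - 1 = k + 4 := by omega
      have hk2 : n - (i + 1) = k + 4 := by omega
      have hk3 : n - (i + 1) - 1 = k + 3 := by omega
      rw [hk3, hk2]
      rw [hk1] at p3
      rw [hk] at p1 p2
      have q1 : ((k + 5 : ℕ) : ZMod n) - 1 = ((k + 4 : ℕ) : ZMod n) := by push_cast; ring
      have q2 : ((k + 5 : ℕ) : ZMod n) - 2 = ((k + 3 : ℕ) : ZMod n) := by push_cast; ring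
      have q3 : ((k + 5 : ℕ) : ZMod n) - 3 = ((k + 2 : ℕ) : ZMod n) := by push_cast; ring
      have Ek := E ((k + 5 : ℕ) : ZMod n)
      have Fk := F ((k + 5 : ℕ) : ZMod n)
      rw [q1, q2, q3, p1, p2, p3, xb (k + 4) (by omega) (by omega),
        xb (k + 3) (by omega) (by omega)] at Ek Fk
      rw [ym (k + 4) (by omega) (by omega), ym (k + 3) (by omega) (by omega)] at Fk
      have hc : c ((k + 4 : ℕ) : ZMod n) = 0 := by
        have : s ^ 2 * c ((k + 4 : ℕ) : ZMod n) = 0 := by linear_combination (-1 / 4) * Ek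
        simpa [hs] using this
      refine ⟨hc, p3, ?_⟩
      rw [hc] at Fk
      have hxne : x ((k + 2 : ℕ) : ZMod n) ≠ 0 := by
        rw [hx]
        split_ifs
        · simpa using hs
        · simpa using hs
      have : (8 * s * x ((k + 2 : ℕ) : ZMod n) * (-1) ^ k) * d ((k + 3 : ℕ) : ZMod n) = 0 := by
        linear_combination Fk
      have h2 : (8 * s * x ((k + 2 : ℕ) : ZMod n) * (-1) ^ k) ≠ 0 := by
        refine mul_ne_zero (mul_ne_zero (mul_ne_zero (by norm_num) hs) hxne) ?_
        exact pow_ne_zero _ (by norm_num)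
      exact (mul_eq_zero.mp this).resolve_left h2
  obtain ⟨c4, d4, d3⟩ := P (n - 4) (by omega)
  have hn4 : n - (n - 4) = 4 := by omega
  rw [hn4] at c4 d4 d3
  have c4' : c 4 = 0 := by simpa using c4
  have d4' : d 4 = 0 := by simpa using d4
  have d3' : d 3 = 0 := by simpa using d3
  have E4 := E 4
  have F4 := F 4
  have t1 : (4 : ZMod n) - 1 = 3 := by ring
  have t2 : (4 : ZMod n) - 2 = 2 := by ring
  have t3 : (4 : ZMod n) - 3 = 1 := by ring
  simp only [t1, t2, t3, c4', d4', d3', x1, x2, x3, y1, y2, y3] at E4 F4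
  have G4 : 2 * c 3 + 3 * (s * d 2) = 0 := by
    have : s ^ 2 * (2 * c 3 + 3 * (s * d 2)) = 0 := by linear_combination E4
    simpa [hs] using this
  have H4 : 3 * c 3 - (s * d 2) = 0 := by
    have : s * (3 * c 3 - (s * d 2)) = 0 := by linear_combination F4
    simpa [hs] using this
  have c3 : c 3 = 0 := by linarith
  have sd2 : s * d 2 = 0 := by linarith
  have hd2 : d 2 = 0 := by simpa [hs] using sd2
  have hc2 : c 2 = 0 := by linarith
  have all : ∀ m : ℕ, m < n → c (m : ZMod n) = 0 ∧ d (m : ZMod n) = 0 := by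
    intro m hm
    by_cases h4 : 4 ≤ m
    · obtain ⟨p, q, _⟩ := P (n - m) (by omega)
      have : n - (n - m) = m := by omega
      rw [this] at p q
      exact ⟨p, q⟩
    · have h : m = 0 ∨ m = 1 ∨ m = 2 ∨ m = 3 := by omega
      rcases h with rfl | rfl | rfl | rfl
      · exact ⟨by simpa using c0, by simpa using d0⟩
      · exact ⟨by simpa using c1, by simpa using hd1⟩
      · exact ⟨by simpa using hc2, by simpa using hd2⟩
      · exact ⟨by simpa using c3, by simpa using d3'⟩
  constructor
  · intro m
    have := (all m.val (ZMod.val_lt m)).1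
    simpa using this
  · intro m
    have := (all m.val (ZMod.val_lt m)).2
    simpa using this

/-- at the point `x = (a, a, b, …, b)`,
`η = (1, −1, 1, −1, …)` (with `η_n = 0` for odd `n`), where `a = −R/√(4n−6)` and
`b = √2 R/√(2n−3)`, the `2n − 2` lifted vectors
`Ṽ_1(x,η), …, Ṽ_n(x,η)` and `[Ṽ_i, Ṽ_{i+1}](x,η)`, `i = 1, …, n−2`,
are linearly independent in `ℝ²ⁿ`. -/
theorem lorenz_lifted_lie_bracket_spanning
    (n : ℕ) [NeZero n] (hn : 4 ≤ n) (R : ℝ) (hR : 0 < R) :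
    let a : ℝ := -R / Real.sqrt (4 * (n : ℝ) - 6)
    let b : ℝ := Real.sqrt 2 * R / Real.sqrt (2 * (n : ℝ) - 3)
    let x : ZMod n → ℝ := fun i => if i = 1 ∨ i = 2 then a else b
    let η : ZMod n → ℝ := fun i =>
      if Even n then (-1 : ℝ) ^ (i.val + 1)
      else if i = 0 then 0 else (-1 : ℝ) ^ (i.val + 1)
    LinearIndependent ℝ
      (fun idx : ZMod n ⊕ Fin (n - 2) =>
        match idx with
        | Sum.inl j => liftField n (lorenzSplit n j) (x, η)
        | Sum.inr i =>
            lieBracket n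
              (liftField n (lorenzSplit n (((i : ℕ) + 1 : ℕ) : ZMod n)))
              (liftField n (lorenzSplit n (((i : ℕ) + 2 : ℕ) : ZMod n)))
              (x, η)) := by
  intro a b x η
  set s : ℝ := R / Real.sqrt (4 * (n : ℝ) - 6) with hs
  have hn' : (4 : ℝ) ≤ n := by exact_mod_cast hn
  have hpos : 0 < Real.sqrt (4 * (n : ℝ) - 6) := Real.sqrt_pos.mpr (by linarith)
  have hs0 : s ≠ 0 := (div_pos hR hpos).ne'
  have ha : a = -s := by simp only [a, hs]; ring
  have hb : b = 2 * s := by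
    have h1 : Real.sqrt (4 * (n : ℝ) - 6) = Real.sqrt 2 * Real.sqrt (2 * (n : ℝ) - 3) := by
      rw [← Real.sqrt_mul (by norm_num)]; congr 1; ring
    have h2 : 0 < Real.sqrt (2 * (n : ℝ) - 3) := Real.sqrt_pos.mpr (by linarith)
    have h3 : 0 < Real.sqrt 2 := by positivity
    have h4 : Real.sqrt 2 ^ 2 = 2 := Real.sq_sqrt (by norm_num)
    simp only [b, hs, h1]
    field_simp
    linarith
  rw [Fintype.linearIndependent_iff]
  intro g hg
  rw [Fintype.sum_sum_type] at hg
  let e : Fin (n - 2) → ZMod n := fun i => (((i : ℕ) + 1 : ℕ) : ZMod n)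
  have hval : ∀ i, (e i).val = i + 1 := by
    intro i
    have := i.2
    simp only [e]
    rw [ZMod.val_natCast, Nat.mod_eq_of_lt (by omega)]
  have he : Function.Injective e := by
    intro i j hij
    have := congrArg ZMod.val hij
    rw [hval, hval] at this
    exact Fin.ext (by omega)
  let d : ZMod n → ℝ := Function.extend e (fun i => g (Sum.inr i)) 0
  let c : ZMod n → ℝ := fun m => g (Sum.inl m)
  have hde : ∀ i, d (e i) = g (Sum.inr i) := fun i => he.extend_apply _ _ i
  have hdn : ∀ m, (¬ ∃ i, e i = m) → d m = 0 := by
    intro m hm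
    simp only [d]
    rw [Function.extend_apply' _ _ _ hm]; rfl
  have hsum : ∑ i : Fin (n - 2), g (Sum.inr i) •
      lieBracket n (liftField n (lorenzSplit n (((i : ℕ) + 1 : ℕ) : ZMod n)))
              (liftField n (lorenzSplit n (((i : ℕ) + 2 : ℕ) : ZMod n))) (x, η)
      = ∑ m, d m • (brA n m x, brB n m x η) := by
    apply Fintype.sum_of_injective e he
    · intro m hm
      rw [hdn m (by simpa using hm), zero_smul]
    · intro i
      have : (((i : ℕ) + 2 : ℕ) : ZMod n) = (((i : ℕ) + 1 : ℕ) : ZMod n) + 1 := by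
        push_cast; ring
      rw [hde, this, bracket_eq n hn]
  have hg2 : ∑ m, c m • (lorenzSplit n m x, lorT n m x η)
      + ∑ m, d m • (brA n m x, brB n m x η) = 0 := by
    rw [← hsum, ← hg]
    congr 1
    apply Finset.sum_congr rfl
    intro m _
    simp only [lift_eq, c]
  have hE := congrArg Prod.fst hg2
  have hF := congrArg Prod.snd hg2
  simp only [Prod.fst_add, Prod.snd_add, Prod.fst_sum, Prod.snd_sum, Prod.smul_fst,
    Prod.smul_snd, Prod.fst_zero, Prod.snd_zero] at hE hF
  have res := core n hn s hs0 c d x η (by intro m; simp only [x, ha, hb]) (fun m => rfl)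
    (by
      apply hdn
      rintro ⟨i, hi⟩
      have := hval i
      rw [hi] at this
      simp at this)
    (by
      apply hdn
      rintro ⟨i, hi⟩
      have h := i.2
      have h2 : e i + 1 = 0 := by rw [hi]; ring
      apply zmod_small n (i + 2) (by omega) (by omega)
      rw [← h2]
      simp only [e]
      push_cast
      ring)
    hE hF
  rintro (m | i)
  · exact res.1 m
  · rw [← hde]; exact res.2 _
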